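/- Let d ≥ 0, n ≥ 0, let γ = (j_0, …, j_n) be a strictly increasing integer sequence with j_0 = 0, T := j_n + d + 1, and let t_{0:T} be a nondecreasing knot sequence consisting of rational numbers. Then each SIAC filter coefficient c_{ξ,ℓ} (the ℓ-th entry of the first column of the inverse reproduction matrix for the knot sequence h·t_{0:T} + ξ, h > 0, ξ ∈ ℝ) is a polynomial in ξ and h^{-1} with rational coefficients; in particular, for rational ξ and rational h > 0 all filter coefficients are rational numbers. -/

import Mathlib

/-- Divided difference `[t_i, …, t_j] g` (confluent when the endpoints coincide):
`[t_i]g = g(t_i)`; for `j > i`, `[t_{i:j}]g = ([t_{i+1:j}]g − [t_{i:j−1}]g)/(t_j − t_i)`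
if `t_i ≠ t_j`, and `[t_{i:j}]g = g^{(j−i)}(t_i)/(j−i)!` if `t_i = t_j`. -/
noncomputable def divDiff (g : ℝ → ℝ) (t : ℕ → ℝ) : ℕ → ℕ → ℝ
  | i, j =>
    if _h : j ≤ i then g (t i)
    else if t i = t j then iteratedDeriv (j - i) g (t i) / (j - i).factorial
    else (divDiff g t (i + 1) j - divDiff g t i (j - 1)) / (t j - t i)
termination_by i j => j - i
decreasing_by all_goals omega

/-- B-spline of degree `d` with knot sequence `τ 0 ≤ τ 1 ≤ … ≤ τ (d+1)`:
`B(x|τ) = (τ_{d+1} − τ_0)·[τ_{0:d+1}](max(· − x, 0))^d`. -/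
noncomputable def Bspline (d : ℕ) (τ : ℕ → ℝ) (x : ℝ) : ℝ :=
  (τ (d + 1) - τ 0) * divDiff (fun s => (max (s - x) 0) ^ d) τ 0 (d + 1)

/-- The reproduction matrix `M_{0,t,γ}` with entries
`M(δ,k) = [t_{γ k : γ k + d + 1}] x^{d+1+δ}`. -/
noncomputable def reproMatrix (d n : ℕ) (γ : Fin (n + 1) → ℕ) (t : ℕ → ℝ) :
    Matrix (Fin (n + 1)) (Fin (n + 1)) ℝ :=
  Matrix.of fun δ k => divDiff (fun x => x ^ (d + 1 + (δ : ℕ))) t (γ k) (γ k + d + 1)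

theorem divDiff_self (g : ℝ → ℝ) (t : ℕ → ℝ) (i : ℕ) : divDiff g t i i = g (t i) := by
  rw [divDiff]; simp

theorem divDiff_add_succ (g : ℝ → ℝ) (t : ℕ → ℝ) (i k : ℕ) :
    divDiff g t i (i + (k + 1)) =
      if t i = t (i + (k + 1)) then iteratedDeriv (k + 1) g (t i) / (k + 1).factorial
      else (divDiff g t (i + 1) (i + 1 + k) - divDiff g t i (i + k)) /
        (t (i + (k + 1)) - t i) := by
  rw [divDiff, dif_neg (by omega), show i + (k + 1) - i = k + 1 by omega,
    show i + (k + 1) - 1 = i + k by omega, show i + 1 + k = i + (k + 1) by omega]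

/-- Divided differences are linear on finite sums of smooth functions. -/
theorem divDiff_sum {ι : Type*} (s : Finset ι) (c : ι → ℝ) (f : ι → ℝ → ℝ)
    (hf : ∀ r ∈ s, ContDiff ℝ ⊤ (f r)) (t : ℕ → ℝ) (k i : ℕ) :
    divDiff (fun x => ∑ r ∈ s, c r * f r x) t i (i + k) =
      ∑ r ∈ s, c r * divDiff (f r) t i (i + k) := by
  induction k generalizing i with
  | zero => simp [divDiff_self]
  | succ k ih =>
    simp only [divDiff_add_succ, ih]
    split_ifs with h
    · rw [iteratedDeriv_fun_sum
        (fun r hr => ((contDiff_const.mul (hf r hr)).of_le le_top).contDiffAt), Finset.sum_div]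
      refine Finset.sum_congr rfl fun r hr => ?_
      rw [iteratedDeriv_const_mul_field, mul_div_assoc]
    · rw [← Finset.sum_sub_distrib, Finset.sum_div]
      exact Finset.sum_congr rfl fun r _ => by ring

/-- Divided differences over affinely transformed knots. -/
theorem divDiff_affine (g : ℝ → ℝ) (hg : ContDiff ℝ ⊤ g) (t : ℕ → ℝ) {h : ℝ} (hh : h ≠ 0)
    (ξ : ℝ) (k i : ℕ) :
    divDiff g (fun j => h * t j + ξ) i (i + k) =
      (h ^ k)⁻¹ * divDiff (fun x => g (h * x + ξ)) t i (i + k) := by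
  induction k generalizing i with
  | zero => simp [divDiff_self]
  | succ k ih =>
    simp only [divDiff_add_succ, ih, add_left_inj, mul_right_inj' hh]
    split_ifs with he
    · have h1 : iteratedDeriv (k + 1) (fun x => g (h * x + ξ)) (t i) =
          h ^ (k + 1) * iteratedDeriv (k + 1) g (h * t i + ξ) := by
        have h2 := iteratedDeriv_comp_const_mul (n := k + 1) (f := fun z => g (z + ξ))
          ((hg.comp (contDiff_id.add contDiff_const)).of_le le_top) h
        rw [h2, iteratedDeriv_comp_add_const]
      rw [h1]
      field_simp
    · have h3 : t (i + (k + 1)) - t i ≠ 0 := sub_ne_zero.mpr (Ne.symm he)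
      rw [show h * t (i + (k + 1)) + ξ - (h * t i + ξ) = h * (t (i + (k + 1)) - t i) by ring]
      field_simp
      ring

/-- The geometric series `1 / (1 - a X)`. -/
noncomputable def geomSeries (a : ℝ) : PowerSeries ℝ := PowerSeries.mk fun m => a ^ m

theorem geomSeries_mul (a : ℝ) :
    geomSeries a * (1 - PowerSeries.C a * PowerSeries.X) = 1 := by
  ext m
  rw [mul_sub, mul_one, mul_comm (PowerSeries.C a), ← mul_assoc, map_sub]
  cases m with
  | zero => simp [geomSeries]
  | succ m =>
    rw [PowerSeries.coeff_mul_C, PowerSeries.coeff_succ_mul_X]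
    simp [geomSeries, pow_succ, PowerSeries.coeff_one]

theorem coeff_geomSeries_pow (a : ℝ) (k s : ℕ) :
    PowerSeries.coeff s (geomSeries a ^ (k + 1)) = (k + s).choose k * a ^ s := by
  have h : geomSeries a = PowerSeries.rescale a (PowerSeries.mk 1) := by
    ext; simp [geomSeries]
  rw [h, ← map_pow, PowerSeries.mk_one_pow_eq_mk_choose_add]
  simp [mul_comm]

/-- Divided differences of monomials are complete homogeneous symmetric polynomials in the
knots, given here through their generating function. -/
theorem divDiff_pow (t : ℕ → ℝ) (m k i : ℕ)
    (ht : ∀ a b, i ≤ a → a ≤ b → b ≤ i + k → t a ≤ t b) :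
    divDiff (fun x => x ^ m) t i (i + k) =
      PowerSeries.coeff m
        (PowerSeries.X ^ k * ∏ r ∈ Finset.range (k + 1), geomSeries (t (i + r))) := by
  induction k generalizing i with
  | zero => simp [divDiff_self, geomSeries]
  | succ k ih =>
    rw [divDiff_add_succ]
    split_ifs with he
    · have hall : ∀ r ∈ Finset.range (k + 1 + 1), geomSeries (t (i + r)) = geomSeries (t i) := by
        intro r hr
        rw [Finset.mem_range] at hr
        congr 1
        exact le_antisymm (he ▸ ht _ _ (by omega) (by omega) le_rfl)
          (ht _ _ le_rfl (by omega) (by omega))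
      rw [Finset.prod_congr rfl hall, Finset.prod_const, Finset.card_range,
        PowerSeries.coeff_X_pow_mul', iteratedDeriv_pow]
      split_ifs with hm
      · obtain ⟨s, rfl⟩ := Nat.exists_eq_add_of_le hm
        rw [Nat.add_sub_cancel_left, coeff_geomSeries_pow,
          Nat.descFactorial_eq_factorial_mul_choose]
        have : ((k + 1).factorial : ℝ) ≠ 0 := by positivity
        push_cast
        field_simp
      · rw [Nat.descFactorial_of_lt (not_le.mp hm)]
        simp
    · rw [ih (i + 1) fun a b h1 h2 h3 => ht a b (by omega) h2 (by omega),
        ih i fun a b h1 h2 h3 => ht a b h1 h2 (by omega),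
        div_eq_iff (sub_ne_zero.mpr (Ne.symm he)), ← map_sub, ← PowerSeries.coeff_mul_C]
      congr 1
      have hfirst := geomSeries_mul (t i)
      have hlast := geomSeries_mul (t (i + (k + 1)))
      have e1 : ∏ r ∈ Finset.range (k + 1), geomSeries (t (i + 1 + r)) =
          (∏ r ∈ Finset.range k, geomSeries (t (i + (r + 1)))) *
            geomSeries (t (i + (k + 1))) := by
        rw [Finset.prod_range_succ]
        simp only [add_assoc, add_comm 1]
      have e2 : ∏ r ∈ Finset.range (k + 1), geomSeries (t (i + r)) =
          (∏ r ∈ Finset.range k, geomSeries (t (i + (r + 1)))) * geomSeries (t i) := by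
        rw [Finset.prod_range_succ']; rfl
      rw [Finset.prod_range_succ (n := k + 1), e1, e2, map_sub, pow_succ]
      generalize ∏ r ∈ Finset.range k, geomSeries (t (i + (r + 1))) = P
      generalize geomSeries (t i) = u at *
      generalize geomSeries (t (i + (k + 1))) = v at *
      linear_combination (PowerSeries.X ^ k * P) * (u * hlast - v * hfirst)

theorem divDiff_pow_of_lt (t : ℕ → ℝ) {m k : ℕ} (hmk : m < k) (i : ℕ)
    (ht : ∀ a b, i ≤ a → a ≤ b → b ≤ i + k → t a ≤ t b) :
    divDiff (fun x => x ^ m) t i (i + k) = 0 := by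
  rw [divDiff_pow t m k i ht, PowerSeries.coeff_X_pow_mul', if_neg (not_le.mpr hmk)]

theorem exists_rat_divDiff_pow (t : ℕ → ℝ) (m k i : ℕ)
    (ht : ∀ j, i ≤ j → j ≤ i + k → ∃ q : ℚ, t j = q) :
    ∃ q : ℚ, divDiff (fun x => x ^ m) t i (i + k) = q := by
  induction k generalizing i with
  | zero =>
    obtain ⟨q, hq⟩ := ht i le_rfl le_rfl
    exact ⟨q ^ m, by simp [divDiff_self, hq]⟩
  | succ k ih =>
    obtain ⟨a, ha⟩ := ht i le_rfl (by omega)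
    obtain ⟨b, hb⟩ := ht (i + (k + 1)) (by omega) le_rfl
    obtain ⟨u, hu⟩ := ih (i + 1) fun j h1 h2 => ht j (by omega) (by omega)
    obtain ⟨v, hv⟩ := ih i fun j h1 h2 => ht j (by omega) (by omega)
    rw [divDiff_add_succ]
    split_ifs
    · refine ⟨m.descFactorial (k + 1) * a ^ (m - (k + 1)) / (k + 1).factorial, ?_⟩
      rw [iteratedDeriv_pow, ha]
      push_cast
      rfl
    · exact ⟨(u - v) / (b - a), by rw [hu, hv, ha, hb]; push_cast; rfl⟩

/-- The matrix relating the reproduction matrices for the knots `h • t + ξ` and `t`. -/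
noncomputable def affineTransfer (d n : ℕ) (h ξ : ℝ) : Matrix (Fin (n + 1)) (Fin (n + 1)) ℝ :=
  Matrix.of fun δ m =>
    (d + 1 + (δ : ℕ)).choose (d + 1 + (m : ℕ)) * h ^ (m : ℕ) * ξ ^ ((δ : ℕ) - (m : ℕ))

theorem reproMatrix_affine (d n : ℕ) (γ : Fin (n + 1) → ℕ) (hγ : StrictMono γ) (t : ℕ → ℝ)
    (hmono : ∀ i j : ℕ, i ≤ j → j ≤ γ (Fin.last n) + d + 1 → t i ≤ t j)
    {h : ℝ} (hh : h ≠ 0) (ξ : ℝ) :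
    reproMatrix d n γ (fun i => h * t i + ξ) =
      affineTransfer d n h ξ * reproMatrix d n γ t := by
  ext δ k
  have hk : γ k ≤ γ (Fin.last n) := hγ.monotone (Fin.le_last k)
  have hδ : (δ : ℕ) < n + 1 := δ.isLt
  have hzero : ∀ r < d + 1, divDiff (fun x => x ^ r) t (γ k) (γ k + (d + 1)) = 0 := fun r hr =>
    divDiff_pow_of_lt t hr _ fun a b _ h2 h3 => hmono a b h2 (by omega)
  simp only [reproMatrix, affineTransfer, Matrix.mul_apply, Matrix.of_apply]
  rw [add_assoc (γ k), divDiff_affine (fun x => x ^ (d + 1 + (δ : ℕ))) (contDiff_id.pow _) t hh]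
  have hexp : (fun x : ℝ => (h * x + ξ) ^ (d + 1 + (δ : ℕ))) = fun x =>
      ∑ r ∈ Finset.range (d + 1 + (n + 1)),
        ((d + 1 + (δ : ℕ)).choose r * h ^ r * ξ ^ (d + 1 + (δ : ℕ) - r)) * x ^ r := by
    funext x
    rw [add_pow]
    refine Finset.sum_subset_zero_on_sdiff (by simp; omega) ?_ fun r _ => by
      rw [mul_pow]; ring
    intro r hr
    simp only [Finset.mem_sdiff, Finset.mem_range] at hr
    rw [Nat.choose_eq_zero_of_lt (by omega)]
    simp
  rw [hexp, divDiff_sum _ _ (fun r x => x ^ r) (fun r _ => contDiff_id.pow r),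
    Finset.sum_range_add, Finset.sum_eq_zero fun r hr => by
      rw [hzero r (Finset.mem_range.mp hr), mul_zero], zero_add, Finset.mul_sum,
    ← Fin.sum_univ_eq_sum_range (fun m => (h ^ (d + 1))⁻¹ *
      ((d + 1 + (δ : ℕ)).choose (d + 1 + m) * h ^ (d + 1 + m) *
        ξ ^ (d + 1 + (δ : ℕ) - (d + 1 + m)) *
        divDiff (fun x => x ^ (d + 1 + m)) t (γ k) (γ k + (d + 1))))]
  refine Finset.sum_congr rfl fun m _ => ?_
  rw [Nat.add_sub_add_left, pow_add h (d + 1)]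
  field_simp

theorem isUnit_det_affineTransfer (d n : ℕ) {h : ℝ} (hh : h ≠ 0) (ξ : ℝ) :
    IsUnit (affineTransfer d n h ξ).det := by
  rw [Matrix.det_of_isLowerTriangular, isUnit_iff_ne_zero, Finset.prod_ne_zero_iff]
  · intro m _
    simp [affineTransfer, hh]
  · intro δ m hlt
    have : (δ : ℕ) < m := hlt
    simp [affineTransfer, Nat.choose_eq_zero_of_lt (show d + 1 + (δ : ℕ) < d + 1 + m by omega)]

/-- The first column of the inverse transfer matrix. -/
theorem affineTransfer_inv_apply_zero (d n : ℕ) {h : ℝ} (hh : h ≠ 0) (ξ : ℝ) (m : Fin (n + 1)) :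
    (affineTransfer d n h ξ)⁻¹ m 0 =
      (d + 1 + (m : ℕ)).choose (d + 1) * (-ξ) ^ (m : ℕ) * h⁻¹ ^ (m : ℕ) := by
  set v : Fin (n + 1) → ℝ := fun m =>
    (d + 1 + (m : ℕ)).choose (d + 1) * (-ξ) ^ (m : ℕ) * h⁻¹ ^ (m : ℕ) with hv
  have hmul : (affineTransfer d n h ξ).mulVec v = Pi.single 0 1 := by
    ext δ
    have hterm : ∀ r : ℕ, ((d + 1 + (δ : ℕ)).choose (d + 1 + r) * h ^ r * ξ ^ ((δ : ℕ) - r)) *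
        ((d + 1 + r).choose (d + 1) * (-ξ) ^ r * h⁻¹ ^ r) =
        (d + 1 + (δ : ℕ)).choose (d + 1) *
          ((-ξ) ^ r * ξ ^ ((δ : ℕ) - r) * (δ : ℕ).choose r) := by
      intro r
      have hc : ((d + 1 + (δ : ℕ)).choose (d + 1 + r) : ℝ) * (d + 1 + r).choose (d + 1) =
          (d + 1 + (δ : ℕ)).choose (d + 1) * (δ : ℕ).choose r := by
        by_cases hr : r ≤ δ
        · have := Nat.choose_mul (n := d + 1 + δ) (k := d + 1 + r) (s := d + 1)
            (by omega)
          rw [Nat.add_sub_cancel_left, Nat.add_sub_cancel_left] at this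
          exact_mod_cast this
        · rw [Nat.choose_eq_zero_of_lt (by omega : d + 1 + (δ : ℕ) < d + 1 + r),
            Nat.choose_eq_zero_of_lt (by omega : (δ : ℕ) < r)]
          simp
      have hp : h ^ r * h⁻¹ ^ r = 1 := by rw [← mul_pow, mul_inv_cancel₀ hh, one_pow]
      linear_combination (h ^ r * h⁻¹ ^ r * ξ ^ ((δ : ℕ) - r) * (-ξ) ^ r) * hc +
        ((d + 1 + (δ : ℕ)).choose (d + 1) *
          ((-ξ) ^ r * ξ ^ ((δ : ℕ) - r) * (δ : ℕ).choose r)) * hp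
    have hsum : ∑ r ∈ Finset.range (n + 1),
        ((-ξ) ^ r * ξ ^ ((δ : ℕ) - r) * (δ : ℕ).choose r) = 0 ^ (δ : ℕ) := by
      rw [← neg_add_cancel ξ, add_pow]
      refine (Finset.sum_subset (by have := δ.isLt; simp; omega) ?_).symm
      intro r _ hr
      rw [Finset.mem_range] at hr
      rw [Nat.choose_eq_zero_of_lt (by omega)]
      simp
    simp only [Matrix.mulVec, dotProduct, affineTransfer, Matrix.of_apply, hv, hterm]
    rw [← Finset.mul_sum, Fin.sum_univ_eq_sum_range
      (fun r => (-ξ) ^ r * ξ ^ ((δ : ℕ) - r) * ((δ : ℕ).choose r : ℝ)), hsum]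
    by_cases h0 : δ = 0
    · simp [h0]
    · simp [h0, Fin.val_ne_zero_iff.mpr h0]
  have hinv := congrArg (affineTransfer d n h ξ)⁻¹.mulVec hmul
  rw [Matrix.mulVec_mulVec, Matrix.nonsing_inv_mul _ (isUnit_det_affineTransfer d n hh ξ),
    Matrix.one_mulVec, Matrix.mulVec_single_one] at hinv
  exact (congrFun hinv m).symm

theorem inv_map_algebraMap {ι : Type*} [Fintype ι] [DecidableEq ι] (Q : Matrix ι ι ℚ) :
    (Q.map (algebraMap ℚ ℝ))⁻¹ = Q⁻¹.map (algebraMap ℚ ℝ) := by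
  ext i j
  have hdet := RingHom.map_det (algebraMap ℚ ℝ) Q
  have hadj := RingHom.map_adjugate (algebraMap ℚ ℝ) Q
  simp only [RingHom.mapMatrix_apply] at hdet hadj
  simp only [Matrix.inv_def, ← hdet, ← hadj, Ring.inverse_eq_inv', Matrix.smul_apply,
    Matrix.map_apply, smul_eq_mul, map_mul, map_inv₀]

/-- **rational SIAC filter coefficients.** If the knots `t_{0:T}` are
rational, then each SIAC filter coefficient `c_{ξ,ℓ}` — the `ℓ`-th entry of the first
column of the inverse reproduction matrix for the knots `h·t + ξ` — is (the evaluation of)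
a polynomial in `ξ` and `h⁻¹` with rational coefficients; in particular for rational `ξ`
and rational `h > 0` all filter coefficients are rational. -/
theorem siac_coeffs_rational (d n : ℕ) (γ : Fin (n + 1) → ℕ)
    (hγ : StrictMono γ) (hγ0 : γ 0 = 0)
    (t : ℕ → ℝ)
    (hmono : ∀ i j : ℕ, i ≤ j → j ≤ γ (Fin.last n) + d + 1 → t i ≤ t j)
    (hrat : ∀ i : ℕ, i ≤ γ (Fin.last n) + d + 1 → ∃ q : ℚ, t i = (q : ℝ)) :
    ∀ ℓ : Fin (n + 1), ∃ p : MvPolynomial (Fin 2) ℚ,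
      (∀ (h ξ : ℝ), 0 < h →
        (reproMatrix d n γ (fun i => h * t i + ξ))⁻¹ ℓ 0
          = MvPolynomial.eval₂ (algebraMap ℚ ℝ) ![ξ, h⁻¹] p)
      ∧ ∀ (h ξ : ℚ), 0 < h →
          ∃ q : ℚ, (reproMatrix d n γ (fun i => (h : ℝ) * t i + (ξ : ℝ)))⁻¹ ℓ 0 = (q : ℝ) := by
  intro ℓ
  have hent : ∀ δ k : Fin (n + 1), ∃ q : ℚ, reproMatrix d n γ t δ k = q := fun δ k =>
    exists_rat_divDiff_pow t _ (d + 1) (γ k) fun j _ hj => hrat j <| by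
      have := hγ.monotone (Fin.le_last k)
      omega
  choose Q hQ using hent
  have hM : reproMatrix d n γ t = (Matrix.of Q).map (algebraMap ℚ ℝ) := by
    ext δ k
    simp [hQ]
  have key : ∀ h ξ : ℝ, 0 < h → (reproMatrix d n γ (fun i => h * t i + ξ))⁻¹ ℓ 0 =
      ∑ m : Fin (n + 1), ((Matrix.of Q)⁻¹ ℓ m : ℝ) *
        ((d + 1 + (m : ℕ)).choose (d + 1) * (-ξ) ^ (m : ℕ) * h⁻¹ ^ (m : ℕ)) := by
    intro h ξ hh
    rw [reproMatrix_affine d n γ hγ t hmono hh.ne' ξ, Matrix.mul_inv_rev, hM,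
      inv_map_algebraMap, Matrix.mul_apply]
    simp [affineTransfer_inv_apply_zero d n hh.ne' ξ]
  refine ⟨∑ m : Fin (n + 1), MvPolynomial.C ((Matrix.of Q)⁻¹ ℓ m) *
    (((d + 1 + (m : ℕ)).choose (d + 1) : MvPolynomial (Fin 2) ℚ) *
      (-MvPolynomial.X 0) ^ (m : ℕ) * MvPolynomial.X 1 ^ (m : ℕ)), fun h ξ hh => ?_,
    fun h ξ hh => ?_⟩
  · rw [key h ξ hh, ← MvPolynomial.coe_eval₂Hom]
    simp
  · refine ⟨∑ m : Fin (n + 1), (Matrix.of Q)⁻¹ ℓ m *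
      ((d + 1 + (m : ℕ)).choose (d + 1) * (-ξ) ^ (m : ℕ) * h⁻¹ ^ (m : ℕ)), ?_⟩
    rw [key h ξ (by exact_mod_cast hh)]
    push_cast
    rfl
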